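/- arXiv:2306.10369 — 6 statements merged into one kernel-verified Lean document; each statement's English description precedes it below -/
import Mathlib

section
/- Let Y be a real-valued random variable on a probability space with E[Y] = 0, |Y| ≤ M almost surely for some M > 0, and E[Y²] ≥ σ² for some σ > 0. Then P(Y ≥ σ²/(4M)) ≥ σ²/(4M²). -/
open MeasureTheory

/-- A point of `[-M, M]` satisfies `y ^ 2 ≤ 2 M (t + M 1_{t ≤ y}) - M y`. -/
lemma sq_le_two_mul_add_indicator_sub {y M t : ℝ} (ht : 0 ≤ t) (hy : |y| ≤ M) :
    y ^ 2 ≤ 2 * M * t + 2 * M ^ 2 * (Set.Ici t).indicator 1 y - M * y := by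
  obtain ⟨h₁, h₂⟩ := abs_le.mp hy
  have hM : 0 ≤ M := (abs_nonneg y).trans hy
  by_cases h : t ≤ y
  · rw [Set.indicator_of_mem (Set.mem_Ici.mpr h), Pi.one_apply]
    nlinarith [mul_nonneg hM ht]
  · rw [Set.indicator_of_notMem (by simpa using h)]
    rcases le_total 0 y with h0 | h0 <;>
      nlinarith [mul_nonneg hM ht, mul_nonneg hM (sub_nonneg.mpr (not_le.mp h).le)]

/-- Scalar small-ball estimate: a bounded, zero-mean real random variable with
variance bounded below has a quantitative positive-tail probability. -/
theorem stmt_0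
    {Ω : Type*} [MeasurableSpace Ω] (μ : Measure Ω) [IsProbabilityMeasure μ]
    (Y : Ω → ℝ) (M σ : ℝ) (hM : 0 < M) (hσ : 0 < σ)
    (hmeas : Measurable Y)
    (hmean : ∫ ω, Y ω ∂μ = 0)
    (hbdd : ∀ᵐ ω ∂μ, |Y ω| ≤ M)
    (hvar : σ ^ 2 ≤ ∫ ω, (Y ω) ^ 2 ∂μ) :
    ENNReal.ofReal (σ ^ 2 / (4 * M ^ 2)) ≤ μ {ω | σ ^ 2 / (4 * M) ≤ Y ω} := by
  set t := σ ^ 2 / (4 * M) with ht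
  have ht0 : 0 ≤ t := by positivity
  have hA : MeasurableSet {ω | t ≤ Y ω} := measurableSet_le measurable_const hmeas
  have hY : Integrable Y μ := .of_bound hmeas.aestronglyMeasurable M hbdd
  have hY2 : Integrable (fun ω => Y ω ^ 2) μ := by
    refine .of_bound (hmeas.pow_const 2).aestronglyMeasurable (M ^ 2) ?_
    filter_upwards [hbdd] with ω hω
    rw [norm_pow, Real.norm_eq_abs]
    gcongr
  have hI : Integrable ({ω | t ≤ Y ω}.indicator (1 : Ω → ℝ)) μ :=
    (integrable_const (1 : ℝ)).indicator hA
  have hsum : Integrable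
      (fun ω => 2 * M * t + 2 * M ^ 2 * {ω | t ≤ Y ω}.indicator (1 : Ω → ℝ) ω) μ :=
    (integrable_const _).add (hI.const_mul _)
  have key : ∫ ω, Y ω ^ 2 ∂μ ≤
      ∫ ω, (2 * M * t + 2 * M ^ 2 * {ω | t ≤ Y ω}.indicator (1 : Ω → ℝ) ω - M * Y ω) ∂μ := by
    refine integral_mono_ae hY2 (hsum.sub (hY.const_mul M)) ?_
    filter_upwards [hbdd] with ω hω
    exact sq_le_two_mul_add_indicator_sub ht0 hω
  rw [integral_sub hsum (hY.const_mul M), integral_add (integrable_const _) (hI.const_mul _),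
    integral_const, probReal_univ, one_smul, integral_const_mul, integral_const_mul, hmean,
    integral_indicator_one hA] at key
  have hMt : 2 * M * t = σ ^ 2 / 2 := by
    rw [ht]
    field_simp
    norm_num
  rw [← ofReal_measureReal]
  refine ENNReal.ofReal_le_ofReal ?_
  rw [div_le_iff₀ (by positivity)]
  linarith
end

section
/- Let w be a random vector taking values in ℝ^n that satisfies the bounded-noise condition with parameters (σ, M). Then for every unit vector λ ∈ ℝ^n, P(λᵀw ≥ σ²/(4M)) ≥ σ²/(4M²). -/
open MeasureTheory
open scoped RealInnerProductSpace

/-- Small-ball estimate for a centred bounded real random variable: if `|X| ≤ M` almost surely and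
the second moment of `X` is at least `v`, then `P(X ≥ v/(4M)) ≥ v/(4M²)`. -/
theorem measureReal_ge_of_centred_of_abs_le {Ω : Type*} [MeasurableSpace Ω] {μ : Measure Ω}
    [IsProbabilityMeasure μ] {X : Ω → ℝ} {v M : ℝ} (hv : 0 ≤ v) (hM : 0 < M)
    (hX : Measurable X) (hmean : ∫ ω, X ω ∂μ = 0) (hbdd : ∀ᵐ ω ∂μ, |X ω| ≤ M)
    (hsq : v ≤ ∫ ω, X ω ^ 2 ∂μ) :
    v / (4 * M ^ 2) ≤ μ.real {ω | v / (4 * M) ≤ X ω} := by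
  set A : Set Ω := {ω | v / (4 * M) ≤ X ω}
  have hA : MeasurableSet A := measurableSet_le measurable_const hX
  have hint : Integrable X μ := Integrable.of_bound hX.aestronglyMeasurable M hbdd
  have hind : Integrable (A.indicator fun _ ↦ 2 * M ^ 2) μ :=
    (integrable_const (2 * M ^ 2)).indicator hA
  have hsum : Integrable (fun ω ↦ v / 2 + A.indicator (fun _ ↦ 2 * M ^ 2) ω) μ :=
    (integrable_const (v / 2)).add hind
  have hpt : ∀ᵐ ω ∂μ, X ω ^ 2 ≤ v / 2 + A.indicator (fun _ ↦ 2 * M ^ 2) ω - M * X ω := by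
    filter_upwards [hbdd] with ω hω
    obtain ⟨hl, hu⟩ := abs_le.mp hω
    by_cases hmem : ω ∈ A
    · rw [Set.indicator_of_mem hmem]
      nlinarith
    · rw [Set.indicator_of_notMem hmem]
      have hlt : X ω * (4 * M) < v := (lt_div_iff₀ (by positivity)).mp (not_le.mp hmem)
      rcases le_total 0 (X ω) with h0 | h0 <;> nlinarith
  have hle : ∫ ω, X ω ^ 2 ∂μ ≤ v / 2 + μ.real A * (2 * M ^ 2) := by
    calc ∫ ω, X ω ^ 2 ∂μ
        ≤ ∫ ω, (v / 2 + A.indicator (fun _ ↦ 2 * M ^ 2) ω - M * X ω) ∂μ :=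
          integral_mono_of_nonneg (.of_forall fun ω ↦ sq_nonneg (X ω))
            (hsum.sub (hint.const_mul M)) hpt
      _ = v / 2 + μ.real A * (2 * M ^ 2) := by
          rw [integral_sub hsum (hint.const_mul M), integral_add (integrable_const _) hind,
            integral_const_mul, hmean, integral_indicator_const _ hA]
          simp
  rw [div_le_iff₀ (by positivity)]
  linarith

/-- Lemma 4 of the paper (positive tail): a zero-mean random vector in ℝⁿ, bounded by `M`
almost surely and with covariance bounded below by `σ² I`, satisfies
`P(λᵀw ≥ σ²/(4M)) ≥ σ²/(4M²)` for every unit vector `λ`. -/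
theorem stmt_3
    {Ω : Type*} [MeasurableSpace Ω] (μ : Measure Ω) [IsProbabilityMeasure μ]
    (n : ℕ) (w : Ω → EuclideanSpace ℝ (Fin n)) (σ M : ℝ) (hσ : 0 < σ) (hM : 0 < M)
    (hmeas : Measurable w)
    (hmean : ∫ ω, w ω ∂μ = 0)
    (hbdd : ∀ᵐ ω ∂μ, ‖w ω‖ ≤ M)
    (hcov : ∀ l : EuclideanSpace ℝ (Fin n), ‖l‖ = 1 → σ ^ 2 ≤ ∫ ω, ⟪l, w ω⟫ ^ 2 ∂μ) :
    ∀ l : EuclideanSpace ℝ (Fin n), ‖l‖ = 1 →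
      ENNReal.ofReal (σ ^ 2 / (4 * M ^ 2)) ≤ μ {ω | σ ^ 2 / (4 * M) ≤ ⟪l, w ω⟫} := by
  intro l hl
  have hint : Integrable w μ := Integrable.of_bound hmeas.aestronglyMeasurable M hbdd
  have hmean' : ∫ ω, ⟪l, w ω⟫ ∂μ = 0 := by
    rw [integral_inner hint, hmean, inner_zero_right]
  have hbdd' : ∀ᵐ ω ∂μ, |⟪l, w ω⟫| ≤ M := by
    filter_upwards [hbdd] with ω hω
    exact (abs_real_inner_le_norm l (w ω)).trans (by simpa [hl] using hω)
  exact ENNReal.ofReal_le_of_le_toReal <| measureReal_ge_of_centred_of_abs_le (sq_nonneg σ) hM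
    hmeas.const_inner hmean' hbdd' (hcov l hl)
end

section
/- Let w be a random vector taking values in ℝ^n that satisfies the bounded-noise condition with parameters (σ, M). Then for every unit vector λ ∈ ℝ^n, P(λᵀw ≤ −σ²/(4M)) ≥ σ²/(4M²). -/
open MeasureTheory
open scoped RealInnerProductSpace

/-- A centred real random variable bounded by `M` with second moment at least `s` is at most
`-(s / (4 * M))` with probability at least `s / (4 * M ^ 2)`. -/
theorem measureReal_le_neg_of_abs_le_of_integral_sq_ge
    {Ω : Type*} [MeasurableSpace Ω] {μ : Measure Ω} [IsProbabilityMeasure μ]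
    {X : Ω → ℝ} {s M : ℝ} (hs : 0 ≤ s) (hM : 0 < M) (hX : Measurable X)
    (hmean : ∫ ω, X ω ∂μ = 0) (hbdd : ∀ᵐ ω ∂μ, |X ω| ≤ M) (hsq : s ≤ ∫ ω, X ω ^ 2 ∂μ) :
    s / (4 * M ^ 2) ≤ μ.real {ω | X ω ≤ -(s / (4 * M))} := by
  set A : Set Ω := {ω | X ω ≤ -(s / (4 * M))}
  have hA : MeasurableSet A := measurableSet_le hX measurable_const
  have hXint : Integrable X μ :=
    Integrable.of_bound hX.aestronglyMeasurable M (by simpa only [Real.norm_eq_abs] using hbdd)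
  have hIint : Integrable (A.indicator fun _ ↦ 2 * M ^ 2) μ :=
    (integrable_const _).indicator hA
  have hLint : Integrable (fun ω ↦ M * X ω + s / 2) μ :=
    (hXint.const_mul M).add (integrable_const _)
  have hsqint : Integrable (fun ω ↦ X ω ^ 2) μ := by
    refine Integrable.of_bound (hX.pow_const 2).aestronglyMeasurable (M ^ 2) ?_
    filter_upwards [hbdd] with ω hω
    rw [Real.norm_eq_abs, abs_pow]
    gcongr
  have hle : ∫ ω, X ω ^ 2 ∂μ ≤
      ∫ ω, ((M * X ω + s / 2) + A.indicator (fun _ ↦ 2 * M ^ 2) ω) ∂μ := by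
    refine integral_mono_ae hsqint (hLint.add hIint) ?_
    filter_upwards [hbdd] with ω hω
    obtain ⟨h₁, h₂⟩ := abs_le.mp hω
    by_cases h : ω ∈ A
    · simp only [Set.indicator_of_mem h]
      nlinarith
    · simp only [Set.indicator_of_notMem h, add_zero]
      have h' : -(s / (4 * M)) < X ω := not_le.mp h
      have hMs : M * (s / (4 * M)) = s / 4 := by field_simp
      have h'' : -(s / 4) < M * X ω := by nlinarith
      rcases le_total 0 (X ω) with h0 | h0 <;> nlinarith
  rw [integral_add hLint hIint, integral_add (hXint.const_mul M) (integrable_const _),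
    integral_const_mul, hmean, integral_indicator_const _ hA] at hle
  simp only [mul_zero, integral_const, probReal_univ, smul_eq_mul, one_mul, zero_add] at hle
  rw [div_le_iff₀ (by positivity)]
  linarith

/-- Negative-tail counterpart of Lemma 4 of the paper: a zero-mean random vector in ℝⁿ,
bounded by `M` almost surely and with covariance bounded below by `σ² I`, satisfies
`P(λᵀw ≤ −σ²/(4M)) ≥ σ²/(4M²)` for every unit vector `λ`. -/
theorem stmt_4
    {Ω : Type*} [MeasurableSpace Ω] (μ : Measure Ω) [IsProbabilityMeasure μ]
    (n : ℕ) (w : Ω → EuclideanSpace ℝ (Fin n)) (σ M : ℝ) (hσ : 0 < σ) (hM : 0 < M)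
    (hmeas : Measurable w)
    (hmean : ∫ ω, w ω ∂μ = 0)
    (hbdd : ∀ᵐ ω ∂μ, ‖w ω‖ ≤ M)
    (hcov : ∀ l : EuclideanSpace ℝ (Fin n), ‖l‖ = 1 → σ ^ 2 ≤ ∫ ω, ⟪l, w ω⟫ ^ 2 ∂μ) :
    ∀ l : EuclideanSpace ℝ (Fin n), ‖l‖ = 1 →
      ENNReal.ofReal (σ ^ 2 / (4 * M ^ 2)) ≤ μ {ω | ⟪l, w ω⟫ ≤ -(σ ^ 2 / (4 * M))} := by
  intro l hl
  rw [← ofReal_measureReal]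
  refine ENNReal.ofReal_le_ofReal ?_
  have hint : Integrable w μ := Integrable.of_bound hmeas.aestronglyMeasurable M hbdd
  refine measureReal_le_neg_of_abs_le_of_integral_sq_ge (sq_nonneg σ) hM
    (hmeas.const_inner) ?_ ?_ (hcov l hl)
  · rw [integral_inner hint, hmean, inner_zero_right]
  · filter_upwards [hbdd] with ω hω
    calc |⟪l, w ω⟫| ≤ ‖l‖ * ‖w ω‖ := abs_real_inner_le_norm _ _
      _ ≤ M := by rwa [hl, one_mul]
end

section
/- Fix n, m ≥ 1, real numbers σ_w, w_max, b > 0, a vector a ∈ ℝ^n, and a unit vector λ = (λ₁, λ₂) ∈ ℝ^n × ℝ^m with ‖λ₁‖₂² + ‖λ₂‖₂² = 1. Let W be a random vector in ℝ^n satisfying the bounded-noise condition with parameters (σ_w, w_max), and let U be any random vector in ℝ^m on the same probability space (with arbitrary dependence on W) such that ‖U‖₂ ≤ b almost surely. Set s_w = σ_w²/(4 w_max), p_w = σ_w²/(4 w_max²), and k₀ = max(2/√3, 4b/s_w). If ‖λ₂‖₂ ≤ 1/k₀ and λ₁ᵀa ≥ 0, then P(|λ₁ᵀ(a + W) + λ₂ᵀU|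 ≥ s_w/4) ≥ p_w. -/
open MeasureTheory
open scoped RealInnerProductSpace

/-- A centered random variable bounded by `M` with second moment at least `σ ^ 2` is at least
`σ ^ 2 / (4 * M)` with probability at least `σ ^ 2 / (4 * M ^ 2)`. -/
theorem le_measureReal_of_integral_eq_zero_of_abs_le
    {Ω : Type*} [MeasurableSpace Ω] {μ : Measure Ω} [IsProbabilityMeasure μ]
    {Y : Ω → ℝ} {σ M : ℝ} (hM : 0 < M) (hY : Measurable Y) (hmean : ∫ ω, Y ω ∂μ = 0)
    (hbdd : ∀ᵐ ω ∂μ, |Y ω| ≤ M) (hvar : σ ^ 2 ≤ ∫ ω, Y ω ^ 2 ∂μ) :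
    σ ^ 2 / (4 * M ^ 2) ≤ μ.real {ω | σ ^ 2 / (4 * M) ≤ Y ω} := by
  set s := σ ^ 2 / (4 * M) with hs
  have hs0 : 0 ≤ s := by positivity
  have hA : MeasurableSet {ω | s ≤ Y ω} := measurableSet_le measurable_const hY
  have hYint : Integrable Y μ := .of_bound hY.aestronglyMeasurable M hbdd
  have hY2int : Integrable (fun ω => Y ω ^ 2) μ := by
    refine .of_bound (hY.pow_const 2).aestronglyMeasurable (M ^ 2) ?_
    filter_upwards [hbdd] with ω hω
    rw [Real.norm_eq_abs, abs_pow]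
    gcongr
  have hlower : Integrable (fun ω => Y ω ^ 2 / (2 * M) + Y ω / 2) μ :=
    (hY2int.div_const _).add (hYint.div_const _)
  have hpoint : ∀ᵐ ω ∂μ, Y ω ^ 2 / (2 * M) + Y ω / 2 - s ≤
      {ω | s ≤ Y ω}.indicator (fun _ => M) ω := by
    filter_upwards [hbdd] with ω hω
    obtain ⟨h1, h2⟩ := abs_le.mp hω
    by_cases h : s ≤ Y ω
    · rw [Set.indicator_of_mem (show ω ∈ {ω | s ≤ Y ω} from h)]
      have : Y ω ^ 2 / (2 * M) ≤ M / 2 := by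
        rw [div_le_iff₀ (by positivity)]
        nlinarith
      linarith
    · rw [Set.indicator_of_notMem (show ω ∉ {ω | s ≤ Y ω} from h)]
      push Not at h
      rcases le_total 0 (Y ω) with h0 | h0
      · have : Y ω ^ 2 / (2 * M) ≤ Y ω / 2 := by
          rw [div_le_iff₀ (by positivity)]
          nlinarith
        linarith
      · have : Y ω ^ 2 / (2 * M) ≤ -Y ω / 2 := by
          rw [div_le_iff₀ (by positivity)]
          nlinarith
        linarith
  have hmono := integral_mono_ae (hlower.sub (integrable_const s))
    ((integrable_const M).indicator hA) hpoint
  simp only [Pi.sub_apply] at hmono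
  rw [integral_sub hlower (integrable_const s),
    integral_add (hY2int.div_const _) (hYint.div_const _), integral_div, integral_div, hmean,
    integral_indicator_const _ hA, integral_const, probReal_univ, smul_eq_mul, smul_eq_mul] at hmono
  have hsecond : 2 * s ≤ (∫ ω, Y ω ^ 2 ∂μ) / (2 * M) := by
    rw [hs, le_div_iff₀ (by positivity)]
    calc 2 * (σ ^ 2 / (4 * M)) * (2 * M) = σ ^ 2 := by field_simp; ring
      _ ≤ _ := hvar
  have hratio : σ ^ 2 / (4 * M ^ 2) = s / M := by rw [hs]; field_simp
  rw [hratio, div_le_iff₀ hM]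
  linarith

/-- Case 1 of the proof of Lemma 2 of the paper: when `‖λ₂‖₂ ≤ 1/k₀` and `λ₁ᵀa ≥ 0`,
the randomness of the bounded-noise vector `W` dominates the bounded term `λ₂ᵀU`. -/
theorem stmt_6
    {Ω : Type*} [MeasurableSpace Ω] (μ : Measure Ω) [IsProbabilityMeasure μ]
    (n m : ℕ) (hn : 1 ≤ n) (hm : 1 ≤ m)
    (σw wmax b : ℝ) (hσw : 0 < σw) (hwmax : 0 < wmax) (hb : 0 < b)
    (a l1 : EuclideanSpace ℝ (Fin n)) (l2 : EuclideanSpace ℝ (Fin m))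
    (hunit : ‖l1‖ ^ 2 + ‖l2‖ ^ 2 = 1)
    (W : Ω → EuclideanSpace ℝ (Fin n)) (U : Ω → EuclideanSpace ℝ (Fin m))
    (hWmeas : Measurable W) (hUmeas : Measurable U)
    (hWmean : ∫ ω, W ω ∂μ = 0)
    (hWbdd : ∀ᵐ ω ∂μ, ‖W ω‖ ≤ wmax)
    (hWcov : ∀ l : EuclideanSpace ℝ (Fin n), ‖l‖ = 1 → σw ^ 2 ≤ ∫ ω, ⟪l, W ω⟫ ^ 2 ∂μ)
    (hUbdd : ∀ᵐ ω ∂μ, ‖U ω‖ ≤ b)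
    (sw pw k0 : ℝ)
    (hsw : sw = σw ^ 2 / (4 * wmax)) (hpw : pw = σw ^ 2 / (4 * wmax ^ 2))
    (hk0 : k0 = max (2 / Real.sqrt 3) (4 * b / sw))
    (hl2 : ‖l2‖ ≤ 1 / k0) (ha : 0 ≤ ⟪l1, a⟫) :
    ENNReal.ofReal pw ≤ μ {ω | sw / 4 ≤ |⟪l1, a + W ω⟫ + ⟪l2, U ω⟫|} := by
  have hsw0 : 0 < sw := by rw [hsw]; positivity
  have hk2 : 2 / Real.sqrt 3 ≤ k0 := hk0 ▸ le_max_left _ _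
  have hk4 : 4 * b / sw ≤ k0 := hk0 ▸ le_max_right _ _
  have hk_pos : 0 < k0 := lt_of_lt_of_le (by positivity) hk4
  have hl2b : ‖l2‖ * b ≤ sw / 4 := by
    rw [div_le_iff₀ hsw0] at hk4
    rw [le_div_iff₀ hk_pos] at hl2
    nlinarith [norm_nonneg l2]
  have hl1 : 1 / 2 ≤ ‖l1‖ := by
    have hsqrt : ‖l2‖ ≤ Real.sqrt 3 / 2 := by
      refine hl2.trans ?_
      rw [← one_div_div 2 (Real.sqrt 3)]
      exact one_div_le_one_div_of_le (by positivity) hk2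
    have hsq : ‖l2‖ ^ 2 ≤ (Real.sqrt 3 / 2) ^ 2 := by gcongr
    rw [div_pow, Real.sq_sqrt (by norm_num)] at hsq
    nlinarith [norm_nonneg l1]
  have hl1_pos : 0 < ‖l1‖ := by linarith
  set l := ‖l1‖⁻¹ • l1 with hl
  have hl_norm : ‖l‖ = 1 := norm_smul_inv_norm (𝕜 := ℝ) (norm_pos_iff.mp hl1_pos)
  have hl1_eq : l1 = ‖l1‖ • l := by rw [hl, smul_inv_smul₀ hl1_pos.ne']
  have hWint : Integrable W μ := .of_bound hWmeas.aestronglyMeasurable wmax hWbdd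
  have hmean : ∫ ω, ⟪l, W ω⟫ ∂μ = 0 := by
    rw [integral_inner hWint, hWmean, inner_zero_right]
  have hbdd : ∀ᵐ ω ∂μ, |⟪l, W ω⟫| ≤ wmax := by
    filter_upwards [hWbdd] with ω hω
    refine (abs_real_inner_le_norm _ _).trans ?_
    rwa [hl_norm, one_mul]
  have hprob := le_measureReal_of_integral_eq_zero_of_abs_le hwmax (hWmeas.const_inner (c := l))
    hmean hbdd (hWcov l hl_norm)
  rw [← hpw, ← hsw] at hprob
  refine (ENNReal.ofReal_le_of_le_toReal hprob).trans (measure_mono_ae ?_)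
  filter_upwards [hUbdd] with ω hU hω
  change sw ≤ ⟪l, W ω⟫ at hω
  change sw / 4 ≤ |⟪l1, a + W ω⟫ + ⟪l2, U ω⟫|
  have hW : sw / 2 ≤ ⟪l1, W ω⟫ := by
    rw [hl1_eq, real_inner_smul_left]
    nlinarith
  have hUl : |⟪l2, U ω⟫| ≤ sw / 4 :=
    (abs_real_inner_le_norm _ _).trans ((by gcongr : ‖l2‖ * ‖U ω‖ ≤ ‖l2‖ * b).trans hl2b)
  rw [inner_add_right]
  exact le_trans (by linarith [neg_le_of_abs_le hUl]) (le_abs_self _)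
end

section
/- Fix n, m ≥ 1, real numbers σ_w, w_max, b > 0, a vector a ∈ ℝ^n, and a unit vector λ = (λ₁, λ₂) ∈ ℝ^n × ℝ^m with ‖λ₁‖₂² + ‖λ₂‖₂² = 1. Let W be a random vector in ℝ^n satisfying the bounded-noise condition with parameters (σ_w, w_max), and let U be any random vector in ℝ^m on the same probability space (with arbitrary dependence on W) such that ‖U‖₂ ≤ b almost surely. Set s_w = σ_w²/(4 w_max), p_w = σ_w²/(4 w_max²), and k₀ = max(2/√3, 4b/s_w). If ‖λ₂‖₂ ≤ 1/k₀ and λ₁ᵀa < 0, then P(|λ₁ᵀ(a + W) + λ₂ᵀU| ≥ s_w/4) ≥ p_w. -/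
open MeasureTheory
open scoped RealInnerProductSpace

/-- Negative-tail small-ball bound for a centered bounded real random variable. -/
theorem le_measure_le_neg_of_bounded_of_centered
    {Ω : Type*} [MeasurableSpace Ω] {μ : Measure Ω} [IsProbabilityMeasure μ]
    {X : Ω → ℝ} {σ M : ℝ} (hM : 0 < M) (hX : Measurable X)
    (hmean : ∫ ω, X ω ∂μ = 0) (hbdd : ∀ᵐ ω ∂μ, |X ω| ≤ M)
    (hvar : σ ^ 2 ≤ ∫ ω, X ω ^ 2 ∂μ) :
    ENNReal.ofReal (σ ^ 2 / (4 * M ^ 2)) ≤ μ {ω | X ω ≤ -(σ ^ 2 / (4 * M))} := by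
  set s := σ ^ 2 / (4 * M) with hs
  set S := {ω | X ω ≤ -s}
  have hs0 : 0 ≤ s := by positivity
  have hS : MeasurableSet S := measurableSet_le hX measurable_const
  have hXint : Integrable X μ := Integrable.of_bound hX.aestronglyMeasurable M hbdd
  have hX2int : Integrable (fun ω => X ω ^ 2) μ := by
    refine Integrable.of_bound (hX.pow_const 2).aestronglyMeasurable (M ^ 2) ?_
    filter_upwards [hbdd] with ω hω
    rw [Real.norm_eq_abs, abs_pow]
    gcongr
  have hind : Integrable (S.indicator fun _ => 2 * M ^ 2) μ :=
    (integrable_const _).indicator hS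
  have hpointwise : ∀ᵐ ω ∂μ,
      X ω ^ 2 ≤ M * X ω + 2 * M * s + S.indicator (fun _ => 2 * M ^ 2) ω := by
    filter_upwards [hbdd] with ω hω
    obtain ⟨hlo, hhi⟩ := abs_le.mp hω
    have hMs : 0 ≤ M * s := by positivity
    by_cases hωS : ω ∈ S
    · rw [Set.indicator_of_mem hωS]
      nlinarith
    · rw [Set.indicator_of_notMem hωS]
      have hlt : -s < X ω := not_le.mp hωS
      rcases le_total 0 (X ω) with h | h <;> nlinarith
  have hlin : Integrable (fun ω => M * X ω + 2 * M * s) μ :=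
    (hXint.const_mul M).add (integrable_const _)
  have hle := integral_mono_ae hX2int (hlin.add hind) hpointwise
  have heq : ∫ ω, (M * X ω + 2 * M * s + S.indicator (fun _ => 2 * M ^ 2) ω) ∂μ
      = 2 * M * s + μ.real S * (2 * M ^ 2) := by
    rw [integral_add hlin hind,
      integral_add (hXint.const_mul M) (integrable_const _), integral_const_mul, hmean,
      integral_indicator_const _ hS]
    simp
  have hMs : 2 * M * s = σ ^ 2 / 2 := by
    rw [hs]
    field_simp
    ring
  have hσ : σ ^ 2 ≤ 2 * M * s + μ.real S * (2 * M ^ 2) := hvar.trans (hle.trans_eq heq)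
  refine ENNReal.ofReal_le_of_le_toReal ?_
  change _ ≤ μ.real S
  rw [div_le_iff₀ (by positivity)]
  linarith

/-- Case 2 of the proof of Lemma 2 of the paper: when `‖λ₂‖₂ ≤ 1/k₀` and `λ₁ᵀa < 0`,
the randomness of the bounded-noise vector `W` dominates the bounded term `λ₂ᵀU`. -/
theorem stmt_7
    {Ω : Type*} [MeasurableSpace Ω] (μ : Measure Ω) [IsProbabilityMeasure μ]
    (n m : ℕ) (hn : 1 ≤ n) (hm : 1 ≤ m)
    (σw wmax b : ℝ) (hσw : 0 < σw) (hwmax : 0 < wmax) (hb : 0 < b)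
    (a l1 : EuclideanSpace ℝ (Fin n)) (l2 : EuclideanSpace ℝ (Fin m))
    (hunit : ‖l1‖ ^ 2 + ‖l2‖ ^ 2 = 1)
    (W : Ω → EuclideanSpace ℝ (Fin n)) (U : Ω → EuclideanSpace ℝ (Fin m))
    (hWmeas : Measurable W) (hUmeas : Measurable U)
    (hWmean : ∫ ω, W ω ∂μ = 0)
    (hWbdd : ∀ᵐ ω ∂μ, ‖W ω‖ ≤ wmax)
    (hWcov : ∀ l : EuclideanSpace ℝ (Fin n), ‖l‖ = 1 → σw ^ 2 ≤ ∫ ω, ⟪l, W ω⟫ ^ 2 ∂μ)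
    (hUbdd : ∀ᵐ ω ∂μ, ‖U ω‖ ≤ b)
    (sw pw k0 : ℝ)
    (hsw : sw = σw ^ 2 / (4 * wmax)) (hpw : pw = σw ^ 2 / (4 * wmax ^ 2))
    (hk0 : k0 = max (2 / Real.sqrt 3) (4 * b / sw))
    (hl2 : ‖l2‖ ≤ 1 / k0) (ha : ⟪l1, a⟫ < 0) :
    ENNReal.ofReal pw ≤ μ {ω | sw / 4 ≤ |⟪l1, a + W ω⟫ + ⟪l2, U ω⟫|} := by
  have hsw0 : 0 < sw := by rw [hsw]; positivity
  have hr : 0 < 2 / Real.sqrt 3 := by positivity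
  have hk1 : 2 / Real.sqrt 3 ≤ k0 := hk0 ▸ le_max_left _ _
  have hk2 : 4 * b / sw ≤ k0 := hk0 ▸ le_max_right _ _
  have hl2_le : ‖l2‖ ≤ Real.sqrt 3 / 2 :=
    hl2.trans ((one_div_le_one_div_of_le hr hk1).trans_eq (one_div_div _ _))
  have hl2b : ‖l2‖ * b ≤ sw / 4 := by
    have h : ‖l2‖ ≤ sw / (4 * b) :=
      hl2.trans ((one_div_le_one_div_of_le (by positivity) hk2).trans_eq (one_div_div _ _))
    rw [le_div_iff₀ (by positivity)] at h
    linarith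
  have hl1 : 1 / 2 ≤ ‖l1‖ := by
    have h3 : Real.sqrt 3 ^ 2 = 3 := Real.sq_sqrt (by norm_num)
    have := pow_le_pow_left₀ (norm_nonneg l2) hl2_le 2
    refine (sq_le_sq₀ (by norm_num) (norm_nonneg _)).mp ?_
    nlinarith
  have hl1pos : 0 < ‖l1‖ := by linarith
  set e := ‖l1‖⁻¹ • l1 with he
  have he1 : ‖e‖ = 1 := by
    rw [he, norm_smul, norm_inv, norm_norm, inv_mul_cancel₀ hl1pos.ne']
  have hl1e : l1 = ‖l1‖ • e := by rw [he, smul_inv_smul₀ hl1pos.ne']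
  have hWint : Integrable W μ := Integrable.of_bound hWmeas.aestronglyMeasurable wmax hWbdd
  have htail : ENNReal.ofReal pw ≤ μ {ω | ⟪e, W ω⟫ ≤ -sw} := by
    rw [hpw, hsw]
    refine le_measure_le_neg_of_bounded_of_centered hwmax (by fun_prop) ?_ ?_ (hWcov e he1)
    · rw [integral_inner hWint, hWmean, inner_zero_right]
    · filter_upwards [hWbdd] with ω hω
      have := abs_real_inner_le_norm e (W ω)
      rw [he1, one_mul] at this
      exact this.trans hω
  refine htail.trans (measure_mono_ae ?_)
  filter_upwards [hUbdd] with ω hU (hω : ⟪e, W ω⟫ ≤ -sw)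
  change sw / 4 ≤ |⟪l1, a + W ω⟫ + ⟪l2, U ω⟫|
  have hlW : ⟪l1, W ω⟫ ≤ -(sw / 2) := by
    rw [hl1e, real_inner_smul_left]
    nlinarith
  have hlU : ⟪l2, U ω⟫ ≤ sw / 4 :=
    (real_inner_le_norm l2 (U ω)).trans
      ((mul_le_mul_of_nonneg_left hU (norm_nonneg _)).trans hl2b)
  rw [inner_add_right]
  refine le_trans ?_ (neg_le_abs _)
  linarith
end

section
/- Fix n, m ≥ 1, real numbers σ_η, η_max > 0 and c > 0, a vector a ∈ ℝ^n, and a unit vector λ = (λ₁, λ₂) ∈ ℝ^n × ℝ^m with ‖λ₁‖₂² + ‖λ₂‖₂² = 1 and ‖λ₂‖₂ ≥ c. Let W be an arbitrary random vector in ℝ^n, let H be a random vector in ℝ^m satisfying the bounded-noise condition with parameters (σ_η, η_max) and independent of W, and let G : ℝ^n → ℝ^m be any Borel-measurable function. Set s_η = σ_η²/(4 η_max) and p_η = σ_η²/(4 η_max²). Then P(|λ₁ᵀ(a + W) + λ₂ᵀ(G(W) + H)| ≥ c·s_η) ≥ p_η. -/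
open MeasureTheory ProbabilityTheory
open scoped RealInnerProductSpace

/-- A centred random variable bounded by `M` with second moment at least `v` exceeds `v / (4 * M)`
with probability at least `v / (4 * M ^ 2)`. -/
theorem ofReal_le_measure_le_of_integral_eq_zero {Ω : Type*} [MeasurableSpace Ω] {μ : Measure Ω}
    [IsProbabilityMeasure μ] {X : Ω → ℝ} {v M : ℝ} (hv : 0 ≤ v) (hM : 0 < M)
    (hX : Measurable X) (hbdd : ∀ᵐ ω ∂μ, |X ω| ≤ M) (hmean : ∫ ω, X ω ∂μ = 0)
    (hvar : v ≤ ∫ ω, X ω ^ 2 ∂μ) :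
    ENNReal.ofReal (v / (4 * M ^ 2)) ≤ μ {ω | v / (4 * M) ≤ X ω} := by
  set s := v / (4 * M) with hs
  have hs0 : 0 ≤ s := by positivity
  set A : Set Ω := {ω | s ≤ X ω} with hA
  have hAm : MeasurableSet A := measurableSet_le measurable_const hX
  have hXint : Integrable X μ := Integrable.of_bound hX.aestronglyMeasurable M hbdd
  have hAint : Integrable (A.indicator fun _ ↦ (1 : ℝ)) μ :=
    (integrable_const 1).indicator hAm
  have hXsq : Integrable (fun ω ↦ X ω ^ 2) μ := by
    refine Integrable.of_bound (hX.pow_const 2).aestronglyMeasurable (M ^ 2) ?_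
    filter_upwards [hbdd] with ω hω
    rw [norm_pow, Real.norm_eq_abs]
    gcongr
  have hpt : ∀ᵐ ω ∂μ,
      X ω ^ 2 ≤ (2 * M * s + 2 * M ^ 2 * A.indicator (fun _ ↦ (1 : ℝ)) ω) - M * X ω := by
    filter_upwards [hbdd] with ω hω
    obtain ⟨h1, h2⟩ := abs_le.mp hω
    by_cases h : s ≤ X ω
    · rw [Set.indicator_of_mem (show ω ∈ A from h)]
      nlinarith [mul_nonneg hM.le hs0]
    · rw [Set.indicator_of_notMem (show ω ∉ A from h)]
      push Not at h
      rcases le_total 0 (X ω) with h0 | h0 <;> nlinarith [mul_nonneg hM.le hs0]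
  have hle := integral_mono_ae hXsq
    (((integrable_const (2 * M * s)).add (hAint.const_mul (2 * M ^ 2))).sub (hXint.const_mul M)) hpt
  have hMs : 2 * M * s = v / 2 := by rw [hs]; field_simp; ring
  have hreal : v / (4 * M ^ 2) ≤ μ.real A := by
    rw [integral_sub' ((integrable_const _).add (hAint.const_mul _)) (hXint.const_mul M),
      integral_add' (integrable_const _) (hAint.const_mul _), integral_const_mul (2 * M ^ 2),
      integral_const_mul M, hmean, integral_indicator_const _ hAm, hMs] at hle
    simp only [integral_const, probReal_univ, smul_eq_mul, one_mul, mul_one, mul_zero,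
      sub_zero] at hle
    rw [div_le_iff₀ (by positivity)]
    linarith
  exact ENNReal.ofReal_le_of_le_toReal hreal

/-- If each tail of `Z` beyond `±t` has probability at least `p`, then adding an independent random
variable to `Z` keeps the sum outside `(-t, t)` with probability at least `p`. -/
theorem ProbabilityTheory.IndepFun.le_measure_le_abs_add {Ω : Type*} [MeasurableSpace Ω]
    {μ : Measure Ω} [IsProbabilityMeasure μ] {Y Z : Ω → ℝ} (hYZ : IndepFun Y Z μ)
    (hY : Measurable Y) (hZ : Measurable Z) {t : ℝ} {p : ENNReal}
    (hpos : p ≤ μ {ω | t ≤ Z ω}) (hneg : p ≤ μ {ω | t ≤ -Z ω}) :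
    p ≤ μ {ω | t ≤ |Y ω + Z ω|} := by
  have hpos_eq := hYZ.measure_inter_preimage_eq_mul _ _
    (measurableSet_Ici (a := (0 : ℝ))) (measurableSet_Ici (a := t))
  have hneg_eq := hYZ.measure_inter_preimage_eq_mul _ _
    (measurableSet_Ici (a := (0 : ℝ))).compl (measurableSet_Iic (a := -t))
  have hneg' : p ≤ μ (Z ⁻¹' Set.Iic (-t)) :=
    hneg.trans (measure_mono fun ω (h : t ≤ -Z ω) ↦ show Z ω ≤ -t by linarith)
  have hYm : MeasurableSet (Y ⁻¹' Set.Ici 0) := hY measurableSet_Ici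
  calc p = (μ (Y ⁻¹' Set.Ici 0) + μ (Y ⁻¹' Set.Ici 0)ᶜ) * p := by
        rw [measure_add_measure_compl hYm, measure_univ, one_mul]
    _ ≤ μ (Y ⁻¹' Set.Ici 0) * μ (Z ⁻¹' Set.Ici t)
        + μ (Y ⁻¹' (Set.Ici 0)ᶜ) * μ (Z ⁻¹' Set.Iic (-t)) := by
      rw [add_mul]
      exact add_le_add (mul_le_mul_right hpos _) (mul_le_mul_right hneg' _)
    _ = μ (Y ⁻¹' Set.Ici 0 ∩ Z ⁻¹' Set.Ici t
        ∪ Y ⁻¹' (Set.Ici 0)ᶜ ∩ Z ⁻¹' Set.Iic (-t)) := by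
      rw [← hpos_eq, ← hneg_eq]
      exact (measure_union (disjoint_compl_right.mono Set.inter_subset_left Set.inter_subset_left)
        (hYm.compl.inter (hZ measurableSet_Iic))).symm
    _ ≤ μ {ω | t ≤ |Y ω + Z ω|} := by
      refine measure_mono ?_
      rintro ω (⟨h1, h2⟩ | ⟨h1, h2⟩) <;> change t ≤ |Y ω + Z ω|
      · have h1 : 0 ≤ Y ω := h1
        have h2 : t ≤ Z ω := h2
        exact le_abs.mpr (Or.inl (by linarith))
      · have h1 : Y ω < 0 := not_le.mp h1
        have h2 : Z ω ≤ -t := h2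
        exact le_abs.mpr (Or.inr (by linarith))

/-- Case 3 of the proof of Lemma 2 of the paper: when `‖λ₂‖₂ ≥ c`, the fresh
excitation noise `H` (independent of the process noise `W`) dominates the
history-dependent nominal control `G(W)`. -/
theorem stmt_8
    {Ω : Type*} [MeasurableSpace Ω] (μ : Measure Ω) [IsProbabilityMeasure μ]
    (n m : ℕ) (hn : 1 ≤ n) (hm : 1 ≤ m)
    (ση ηmax c : ℝ) (hση : 0 < ση) (hηmax : 0 < ηmax) (hc : 0 < c)
    (a l1 : EuclideanSpace ℝ (Fin n)) (l2 : EuclideanSpace ℝ (Fin m))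
    (hunit : ‖l1‖ ^ 2 + ‖l2‖ ^ 2 = 1) (hl2 : c ≤ ‖l2‖)
    (W : Ω → EuclideanSpace ℝ (Fin n)) (hWmeas : Measurable W)
    (H : Ω → EuclideanSpace ℝ (Fin m)) (hHmeas : Measurable H)
    (hHmean : ∫ ω, H ω ∂μ = 0)
    (hHbdd : ∀ᵐ ω ∂μ, ‖H ω‖ ≤ ηmax)
    (hHcov : ∀ l : EuclideanSpace ℝ (Fin m), ‖l‖ = 1 → ση ^ 2 ≤ ∫ ω, ⟪l, H ω⟫ ^ 2 ∂μ)
    (hindep : IndepFun W H μ)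
    (G : EuclideanSpace ℝ (Fin n) → EuclideanSpace ℝ (Fin m)) (hG : Measurable G)
    (sη pη : ℝ)
    (hsη : sη = ση ^ 2 / (4 * ηmax)) (hpη : pη = ση ^ 2 / (4 * ηmax ^ 2)) :
    ENNReal.ofReal pη ≤ μ {ω | c * sη ≤ |⟪l1, a + W ω⟫ + ⟪l2, G (W ω) + H ω⟫|} := by
  subst hsη hpη
  have htail : ∀ l : EuclideanSpace ℝ (Fin m), c ≤ ‖l‖ →
      ENNReal.ofReal (ση ^ 2 / (4 * ηmax ^ 2)) ≤
        μ {ω | c * (ση ^ 2 / (4 * ηmax)) ≤ ⟪l, H ω⟫} := by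
    intro l hl
    have hl0 : 0 < ‖l‖ := hc.trans_le hl
    have hnorm : ‖‖l‖⁻¹ • l‖ = 1 := norm_smul_inv_norm (𝕜 := ℝ) (norm_pos_iff.mp hl0)
    have hHint : Integrable H μ := Integrable.of_bound hHmeas.aestronglyMeasurable ηmax hHbdd
    refine (ofReal_le_measure_le_of_integral_eq_zero (X := fun ω ↦ ⟪‖l‖⁻¹ • l, H ω⟫)
      (sq_nonneg ση) hηmax (by fun_prop) ?_ ?_ (hHcov _ hnorm)).trans (measure_mono ?_)
    · filter_upwards [hHbdd] with ω hω
      simpa [hnorm] using (abs_real_inner_le_norm (‖l‖⁻¹ • l) (H ω)).trans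
        (mul_le_mul_of_nonneg_left hω (norm_nonneg _))
    · rw [integral_inner hHint, hHmean, inner_zero_right]
    · intro ω hω
      simp only [Set.mem_ofPred_eq, real_inner_smul_left] at hω ⊢
      rw [inv_mul_eq_div, le_div_iff₀ hl0] at hω
      have : 0 ≤ ση ^ 2 / (4 * ηmax) := by positivity
      nlinarith
  have hindep' : IndepFun (fun ω ↦ ⟪l1, a + W ω⟫ + ⟪l2, G (W ω)⟫) (fun ω ↦ ⟪l2, H ω⟫) μ :=
    hindep.comp (φ := fun w ↦ ⟪l1, a + w⟫ + ⟪l2, G w⟫) (ψ := fun h ↦ ⟪l2, h⟫)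
      (by fun_prop) (by fun_prop)
  have key := hindep'.le_measure_le_abs_add (by fun_prop) (by fun_prop) (htail l2 hl2)
    (by simpa only [inner_neg_left] using htail (-l2) (by rwa [norm_neg]))
  simpa only [inner_add_right l2, ← add_assoc] using key
end
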